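/- There is no minor-universal element for the class of countable K_∞-minor-free graphs. That is, there is no countable graph U such that U has no K_∞ minor and every countable graph with no K_∞ minor is a minor of U. -/

import Mathlib

/-- `H` is a minor of `G` (written `H < G` in the paper): there is a family of pairwise
disjoint nonempty connected branch sets `B v ⊆ V(G)`, indexed by the vertices of `H`,
such that every edge `u v` of `H` is witnessed by a `G`-edge between `B u` and `B v`.
(Nonemptiness of each branch set is part of connectedness of the induced subgraph.) -/
def IsMinor {V : Type*} {W : Type*} (H : SimpleGraph V) (G : SimpleGraph W) : Prop :=
  ∃ B : V → Set W,
    (∀ v : V, (G.induce (B v)).Connected) ∧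
    (∀ u v : V, u ≠ v → Disjoint (B u) (B v)) ∧
    (∀ u v : V, H.Adj u v → ∃ x ∈ B u, ∃ y ∈ B v, G.Adj x y)

namespace SimpleGraph

/-- The graph obtained from `G` by adding a new vertex adjacent to all vertices of `G`. -/
def addApex {V : Type*} (G : SimpleGraph V) : SimpleGraph (Option V) where
  Adj
    | none, none => False
    | some u, some v => G.Adj u v
    | _, _ => True
  symm := ⟨by
    rintro (_ | u) (_ | v) h
    exacts [h, trivial, trivial, G.symm.symm _ _ h]⟩
  loopless := ⟨by
    rintro (_ | u) h
    exacts [h, G.loopless.irrefl u h]⟩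

theorem induce_biUnion_connected {V W : Type*} {H : SimpleGraph V} {G : SimpleGraph W}
    {B : V → Set W} (hB : ∀ v, (G.induce (B v)).Connected)
    (hadj : ∀ u v, H.Adj u v → ∃ x ∈ B u, ∃ y ∈ B v, G.Adj x y)
    {S : Set V} (hS : (H.induce S).Connected) : (G.induce (⋃ v ∈ S, B v)).Connected := by
  have sub : ∀ v ∈ S, B v ⊆ ⋃ v ∈ S, B v := fun v hv => Set.subset_biUnion_of_mem hv
  have within : ∀ v (hv : v ∈ S) x (hx : x ∈ B v) y (hy : y ∈ B v),
      (G.induce (⋃ v ∈ S, B v)).Reachable ⟨x, sub v hv hx⟩ ⟨y, sub v hv hy⟩ :=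
    fun v hv x hx y hy =>
      ((hB v).preconnected ⟨x, hx⟩ ⟨y, hy⟩).map (induceHomOfLE G (sub v hv)).toHom
  have across : ∀ (a b : S), (H.induce S).Walk a b → ∀ x (hx : x ∈ B a) y (hy : y ∈ B b),
      (G.induce (⋃ v ∈ S, B v)).Reachable ⟨x, sub a a.2 hx⟩ ⟨y, sub b b.2 hy⟩ := by
    intro a b p
    induction p with
    | nil => exact within _ (Subtype.property _)
    | @cons a b c h _ ih =>
      intro x hx y hy
      obtain ⟨x', hx', z, hz, hxz⟩ := hadj a b h
      refine (within a a.2 x hx x' hx').trans (Reachable.trans (Adj.reachable ?_) (ih z hz y hy))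
      exact hxz
  obtain ⟨v, hv⟩ := hS.nonempty
  obtain ⟨w, hw⟩ := (hB v).nonempty
  have : Nonempty (⋃ v ∈ S, B v : Set W) := ⟨⟨w, sub v hv hw⟩⟩
  refine ⟨?_⟩
  rintro ⟨x, hx⟩ ⟨y, hy⟩
  obtain ⟨a, ha, hxa⟩ := Set.mem_iUnion₂.1 hx
  obtain ⟨b, hb, hyb⟩ := Set.mem_iUnion₂.1 hy
  obtain ⟨p⟩ := hS.preconnected ⟨a, ha⟩ ⟨b, hb⟩
  exact across _ _ p x hxa y hyb

theorem induce_preimage_some_connected {V : Type*} {G : SimpleGraph V} {S : Set (Option V)}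
    (hS : none ∉ S) (h : (G.addApex.induce S).Connected) :
    (G.induce (some ⁻¹' S)).Connected := by
  have ne : ∀ x : S, x.1 ≠ none := fun x hx => hS (hx ▸ x.2)
  let f : G.addApex.induce S →g G.induce (some ⁻¹' S) :=
    { toFun := fun x => ⟨x.1.get (Option.isSome_iff_ne_none.2 (ne x)), by simp⟩
      map_rel' := by
        rintro ⟨_ | u, hu⟩ ⟨_ | v, hv⟩ huv
        exacts [(hS hu).elim, (hS hu).elim, (hS hv).elim, huv] }
  exact h.map f fun x => ⟨⟨some x.1, x.2⟩, rfl⟩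

end SimpleGraph

theorem IsMinor.of_addApex {V : Type*} {G : SimpleGraph V}
    (h : IsMinor (⊤ : SimpleGraph ℕ) G.addApex) : IsMinor (⊤ : SimpleGraph ℕ) G := by
  obtain ⟨B, hconn, hdisj, hadj⟩ := h
  obtain ⟨k, hk⟩ : ∃ k, ∀ n, none ∉ B (n + k) := by
    by_cases h : ∃ k, none ∈ B k
    · obtain ⟨k, hk⟩ := h
      exact ⟨k + 1, fun n hn => Set.disjoint_left.1 (hdisj (n + (k + 1)) k (by lia)) hn hk⟩
    · exact ⟨0, fun n hn => h ⟨_, hn⟩⟩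
  refine ⟨fun n => some ⁻¹' B (n + k), fun n => SimpleGraph.induce_preimage_some_connected (hk n) (hconn _),
    fun m n hmn => (hdisj _ _ (by lia)).preimage _, fun m n hmn => ?_⟩
  obtain ⟨_ | x, hx, _ | y, hy, hxy⟩ := hadj (m + k) (n + k) (by simpa using hmn)
  exacts [(hk m hx).elim, (hk m hx).elim, (hk n hy).elim, ⟨x, hx, y, hy, hxy⟩]

/-- The branch sets of `K_∞` are obtained from that of the apex by repeatedly applying the model
of `G.addApex` in `G`. -/
theorem IsMinor.top_of_addApex_self {V : Type*} {G : SimpleGraph V} (h : IsMinor G.addApex G) :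
    IsMinor (⊤ : SimpleGraph ℕ) G := by
  obtain ⟨B, hconn, hdisj, hadj⟩ := h
  let Φ : Set V → Set V := fun S => ⋃ v ∈ S, B (some v)
  have mem_Φ : ∀ {S x}, x ∈ Φ S ↔ ∃ v ∈ S, x ∈ B (some v) := by simp [Φ]
  let A : ℕ → Set V := fun n => Φ^[n] (B none)
  have A_succ : ∀ n, A (n + 1) = Φ (A n) := fun n => Function.iterate_succ_apply' Φ n _
  have A_conn : ∀ n, (G.induce (A n)).Connected := by
    intro n
    induction n with
    | zero => exact hconn none
    | succ n ih =>
      rw [A_succ]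
      exact SimpleGraph.induce_biUnion_connected (fun v => hconn (some v))
        (fun u v huv => hadj (some u) (some v) huv) ih
  have A_disj : ∀ m d, Disjoint (A m) (A (m + d + 1)) := by
    intro m d
    rw [Set.disjoint_left]
    induction m with
    | zero =>
      intro x hx hx'
      rw [A_succ, mem_Φ] at hx'
      obtain ⟨v, -, hv⟩ := hx'
      exact Set.disjoint_left.1 (hdisj none (some v) (by simp)) hx hv
    | succ m ih =>
      intro x hx hx'
      rw [show m + 1 + d + 1 = m + d + 1 + 1 by lia] at hx'
      rw [A_succ, mem_Φ] at hx hx'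
      obtain ⟨u, hu, hxu⟩ := hx
      obtain ⟨v, hv, hxv⟩ := hx'
      have huv : u ≠ v := fun e => ih hu (e ▸ hv)
      exact Set.disjoint_left.1 (hdisj (some u) (some v) (by simpa using huv)) hxu hxv
  have A_adj : ∀ m d, ∃ x ∈ A m, ∃ y ∈ A (m + d + 1), G.Adj x y := by
    intro m d
    induction m with
    | zero =>
      obtain ⟨v, hv⟩ := (A_conn (0 + d)).nonempty
      obtain ⟨x, hx, y, hy, hxy⟩ := hadj none (some v) trivial
      exact ⟨x, hx, y, by rw [A_succ, mem_Φ]; exact ⟨v, hv, hy⟩, hxy⟩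
    | succ m ih =>
      obtain ⟨u, hu, v, hv, huv⟩ := ih
      obtain ⟨x, hx, y, hy, hxy⟩ := hadj (some u) (some v) huv
      rw [show m + 1 + d + 1 = m + d + 1 + 1 by lia, A_succ, A_succ]
      exact ⟨x, mem_Φ.2 ⟨u, hu, hx⟩, y, mem_Φ.2 ⟨v, hv, hy⟩, hxy⟩
  refine ⟨A, A_conn, fun m n hmn => ?_, fun m n hmn => ?_⟩
  · obtain h | h := hmn.lt_or_gt <;> obtain ⟨d, rfl⟩ := Nat.exists_eq_add_of_lt h
    exacts [A_disj m d, (A_disj n d).symm]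
  · obtain h | h := hmn.ne.lt_or_gt <;> obtain ⟨d, rfl⟩ := Nat.exists_eq_add_of_lt h
    · exact A_adj m d
    · obtain ⟨x, hx, y, hy, hxy⟩ := A_adj n d
      exact ⟨y, hy, x, hx, hxy.symm⟩

/-- There is no minor-universal element for the class of countable `K_∞`-minor-free graphs:
no countable graph `U` with no `K_∞` minor such that every countable graph with no `K_∞`
minor is a minor of `U`.  (`K_∞` is the complete graph on countably many vertices,
`(⊤ : SimpleGraph ℕ)`.) -/
theorem no_universal_Kinfty_minor_free :
    ¬ ∃ (V : Type) (_ : Countable V) (U : SimpleGraph V),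
        ¬ IsMinor (⊤ : SimpleGraph ℕ) U ∧
        ∀ (W : Type) (_ : Countable W) (G : SimpleGraph W),
          ¬ IsMinor (⊤ : SimpleGraph ℕ) G → IsMinor G U := by
  rintro ⟨V, _, U, hU, huniv⟩
  exact hU (IsMinor.top_of_addApex_self
    (huniv (Option V) inferInstance U.addApex fun h => hU h.of_addApex))
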